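/- Let B be a unital C*-algebra and let 𝔗 be a CPD-semigroup on a set S with values in the bounded linear maps on B. Suppose 𝔗 has a Christensen–Evans generator: for all s,s' ∈ S the limit Ω^{s,s'} := lim_{t→0+} (𝔗_t^{s,s'} − id_B)/t exists in operator norm, and there exist a completely positive definite kernel Ω₀ on S with values in the bounded linear maps on B and elements β_s ∈ B (s ∈ S) with Ω^{s,s'}(b) = Ω₀^{s,s'}(b) + b β_{s'} + β_s* b for all b ∈ B. Then 𝔗 is spatial. -/

import Mathlib

open scoped NNReal

/-- A kernel `K` on a set `S` with values in the bounded linear maps on a unital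
C*-algebra `B` is *completely positive definite* (CPD) if all finite sums
`∑_{i,j} bᵢ* K^{sᵢ,sⱼ}(aᵢ* aⱼ) bⱼ` are positive, i.e. of the form `y* y`. -/
def IsCPDKernel {S : Type*} {B : Type*} [CStarAlgebra B]
    (K : S → S → B →L[ℂ] B) : Prop :=
  ∀ (n : ℕ) (s : Fin n → S) (a b : Fin n → B),
    ∃ y : B, ∑ i, ∑ j, star (b i) * K (s i) (s j) (star (a i) * a j) * b j = star y * y

/-- A CPD-semigroup on `S`: a family of CPD-kernels with `𝔗₀ = id` and
`𝔗_{t+u}^{s,s'} = 𝔗_t^{s,s'} ∘ 𝔗_u^{s,s'}`. -/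
def IsCPDSemigroup {S : Type*} {B : Type*} [CStarAlgebra B]
    (T : ℝ≥0 → S → S → B →L[ℂ] B) : Prop :=
  (∀ t, IsCPDKernel (T t)) ∧
  (∀ s s', T 0 s s' = ContinuousLinearMap.id ℂ B) ∧
  (∀ t u s s', T (t + u) s s' = (T t s s').comp (T u s s'))

/-- A one-parameter semigroup in `B`. -/
def IsOneParamSemigroup {B : Type*} [CStarAlgebra B] (c : ℝ≥0 → B) : Prop :=
  c 0 = 1 ∧ ∀ t u, c (t + u) = c t * c u

/-- The elementary CPD-semigroup implemented by the family of semigroups `c`: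
`𝔖_t^{s,s'}(b) = (c^s_t)* b (c^{s'}_t)`. -/
noncomputable def elemCPD {S : Type*} {B : Type*} [CStarAlgebra B]
    (c : S → ℝ≥0 → B) (t : ℝ≥0) (s s' : S) : B →L[ℂ] B :=
  ContinuousLinearMap.mulLeftRight ℂ B (star (c s t)) (c s' t)

/-- The family `c` of norm-continuous one-parameter semigroups implements a *unit*
for the CPD-semigroup `T`, i.e. `T` dominates the elementary CPD-semigroup of `c`. -/
def IsUnitFor {S : Type*} {B : Type*} [CStarAlgebra B]
    (c : S → ℝ≥0 → B) (T : ℝ≥0 → S → S → B →L[ℂ] B) : Prop :=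
  (∀ s, Continuous (c s) ∧ IsOneParamSemigroup (c s)) ∧
  (∀ t, IsCPDKernel (fun s s' => T t s s' - elemCPD c t s s'))

/-- A CPD-semigroup is *spatial* if it admits a unit. -/
def IsSpatialCPDSemigroup {S : Type*} {B : Type*} [CStarAlgebra B]
    (T : ℝ≥0 → S → S → B →L[ℂ] B) : Prop :=
  ∃ c, IsUnitFor c T

/-- `T` has a *Christensen–Evans generator*: the derivatives
`Ω^{s,s'} = lim_{t→0⁺} (𝔗_t^{s,s'} − id)/t` exist in operator norm and decompose as
`Ω^{s,s'}(b) = Ω₀^{s,s'}(b) + b β_{s'} + β_s* b` with `Ω₀` a CPD-kernel. -/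
def HasChristensenEvansGenerator {S : Type*} {B : Type*} [CStarAlgebra B]
    (T : ℝ≥0 → S → S → B →L[ℂ] B) : Prop :=
  ∃ Ω : S → S → B →L[ℂ] B,
    (∀ s s', Filter.Tendsto
        (fun t : ℝ≥0 => (((t : ℝ) : ℂ))⁻¹ • (T t s s' - ContinuousLinearMap.id ℂ B))
        (nhdsWithin 0 (Set.Ioi 0)) (nhds (Ω s s'))) ∧
    ∃ (Ω₀ : S → S → B →L[ℂ] B) (β : S → B),
      IsCPDKernel Ω₀ ∧
      ∀ s s' (b : B), Ω s s' b = Ω₀ s s' b + b * β s' + star (β s) * b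

section
open Matrix

/-- A self-adjoint element has a compression `p* a p` of the form `-y* y` whose vanishing forces
the element to be positive; `p` is its negative part. -/
theorem IsSelfAdjoint.exists_conjugate_eq_neg_star_mul_self {A : Type*} [CStarAlgebra A] {a : A}
    (ha : IsSelfAdjoint a) :
    ∃ p y : A, star p * a * p = -(star y * y) ∧ (y = 0 → ∃ z, a = star z * z) := by
  let := CStarAlgebra.spectralOrder A
  have := CStarAlgebra.spectralOrderedRing A
  have hp : 0 ≤ a⁻ := CFC.negPart_nonneg a
  have hps : IsSelfAdjoint a⁻ := .of_nonneg hp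
  obtain ⟨y, hy⟩ := CStarAlgebra.nonneg_iff_eq_star_mul_self.1 (hps.conjugate_nonneg hp)
  refine ⟨a⁻, y, ?_, fun h0 => CStarAlgebra.nonneg_iff_eq_star_mul_self.1 ?_⟩
  · rw [hps.star_eq, ← hy]
    conv_lhs => enter [1, 2]; rw [← CFC.posPart_sub_negPart a]
    simp [mul_sub]
  · rw [← CFC.negPart_eq_zero_iff a]
    have h3 : a⁻ * a⁻ * a⁻ = 0 := by simpa [h0] using hy
    have h2 : a⁻ * a⁻ = 0 := by
      rw [← CStarRing.star_mul_self_eq_zero_iff, star_mul, hps.star_eq, ← mul_assoc, h3, zero_mul]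
    rw [← CStarRing.star_mul_self_eq_zero_iff, hps.star_eq, h2]

variable {n : Type*} [Fintype n] [DecidableEq n] {B : Type*}

theorem Matrix.isHermitian_of_isSelfAdjoint_dotProduct_mulVec [Ring B] [StarRing B] [Algebra ℂ B]
    [StarModule ℂ B] {M : Matrix n n B} (h : ∀ b : n → B, IsSelfAdjoint (star b ⬝ᵥ (M *ᵥ b))) :
    M.IsHermitian := by
  have key : ∀ i j (z : ℂ),
      z • star (M j i) + star z • star (M i j) = z • M i j + star z • M j i := by
    intro i j z
    have hi := (h (Pi.single i 1)).star_eq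
    have hj := (h (Pi.single j (algebraMap ℂ B z))).star_eq
    have hij := (h (Pi.single i 1 + Pi.single j (algebraMap ℂ B z))).star_eq
    simp only [star_add, mulVec_add, dotProduct_add, add_dotProduct] at hij
    rw [hi, hj] at hij
    simp [Pi.star_single, ← algebraMap_star_comm, ← Algebra.commutes z, ← Algebra.smul_def] at hij
    rw [← sub_eq_zero] at hij ⊢
    rw [← hij, Complex.star_def]
    abel
  ext i j
  have h1 := key i j 1
  have h2 := congrArg (fun x => (-Complex.I) • x) (key i j Complex.I)
  simp [smul_smul] at h1 h2
  simp only [conjTranspose_apply]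
  linear_combination (norm := module) (1 / 2 : ℂ) • h1 + (1 / 2 : ℂ) • h2

/-- A matrix over a C*-algebra with positive quadratic form is of the form `Y* Y`. -/
theorem Matrix.exists_eq_conjTranspose_mul_self_of_dotProduct_mulVec_nonneg [CStarAlgebra B]
    [PartialOrder B] [StarOrderedRing B] {M : Matrix n n B}
    (h : ∀ b : n → B, 0 ≤ star b ⬝ᵥ (M *ᵥ b)) : ∃ Y : Matrix n n B, M = Yᴴ * Y := by
  have hsa : IsSelfAdjoint (CStarMatrix.ofMatrix M) :=
    Matrix.isHermitian_of_isSelfAdjoint_dotProduct_mulVec fun b => .of_nonneg (h b)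
  obtain ⟨p, y, hpy, hy⟩ := hsa.exists_conjugate_eq_neg_star_mul_self
  refine hy ?_
  set p' : Matrix n n B := CStarMatrix.ofMatrix.symm p
  set y' : Matrix n n B := CStarMatrix.ofMatrix.symm y
  have hpy' : star p' * M * p' = -(star y' * y') := hpy
  have key : ∀ j, 0 ≤ -∑ k, star (y' k j) * y' k j := by
    intro j
    have := h (p' *ᵥ Pi.single j 1)
    rw [star_mulVec, ← dotProduct_mulVec, mulVec_mulVec, mulVec_mulVec] at this
    erw [hpy'] at this
    simpa [Pi.star_single, Matrix.mul_apply, Matrix.star_apply] using this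
  change y' = 0
  ext i j
  have h0 : ∑ k, star (y' k j) * y' k j = 0 :=
    le_antisymm (neg_nonneg.1 (key j)) (Finset.sum_nonneg fun k _ => star_mul_self_nonneg _)
  rw [Finset.sum_eq_zero_iff_of_nonneg fun k _ => star_mul_self_nonneg _] at h0
  exact CStarRing.star_mul_self_eq_zero_iff _ |>.1 (h0 i (Finset.mem_univ _))
end

section
open Filter Topology

theorem norm_pow_sub_pow_le_mul {E : Type*} [NormedRing E] (h1 : ‖(1 : E)‖ ≤ 1) {a b : E} {M : ℝ}
    (hM : 1 ≤ M) (ha : ‖a‖ ≤ M) (hb : ‖b‖ ≤ M) (n : ℕ) :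
    ‖a ^ n - b ^ n‖ ≤ n * M ^ n * ‖a - b‖ := by
  have hpow : ∀ n : ℕ, ‖a ^ n‖ ≤ M ^ n := fun n => by
    rcases n.eq_zero_or_pos with rfl | hn
    · simpa using h1
    · exact (norm_pow_le' a hn).trans (pow_le_pow_left₀ (norm_nonneg a) ha n)
  induction n with
  | zero => simp
  | succ n ih =>
    have hsplit : a ^ (n + 1) - b ^ (n + 1) = a ^ n * (a - b) + (a ^ n - b ^ n) * b := by
      rw [pow_succ, pow_succ]; noncomm_ring
    calc ‖a ^ (n + 1) - b ^ (n + 1)‖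
        ≤ ‖a ^ n‖ * ‖a - b‖ + ‖a ^ n - b ^ n‖ * ‖b‖ := by
          rw [hsplit]
          exact (norm_add_le _ _).trans (add_le_add (norm_mul_le _ _) (norm_mul_le _ _))
      _ ≤ M ^ (n + 1) * ‖a - b‖ + n * M ^ n * ‖a - b‖ * M := by
          gcongr
          exact (hpow n).trans (pow_le_pow_right₀ hM n.le_succ)
      _ = (n + 1 : ℕ) * M ^ (n + 1) * ‖a - b‖ := by push_cast; ring

theorem exists_eventually_norm_le_exp {E : Type*} [NormedRing E] [NormedAlgebra ℂ E]
    (h1 : ‖(1 : E)‖ ≤ 1) {f : ℝ≥0 → E} {ω : E}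
    (hf : Tendsto (fun t : ℝ≥0 => ((t : ℝ) : ℂ)⁻¹ • (f t - 1)) (𝓝[>] 0) (𝓝 ω)) :
    ∀ᶠ t : ℝ≥0 in 𝓝[>] 0, ‖f t‖ ≤ Real.exp ((‖ω‖ + 1) * t) := by
  filter_upwards [hf.norm.eventually_lt_const (lt_add_one ‖ω‖), self_mem_nhdsWithin] with t ht ht0
  have ht0 : (0 : ℝ) < t := ht0
  rw [norm_smul, norm_inv, Complex.norm_real, Real.norm_of_nonneg ht0.le, inv_mul_lt_iff₀ ht0] at ht
  calc ‖f t‖ = ‖(f t - 1) + 1‖ := by simp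
    _ ≤ (‖ω‖ + 1) * t + 1 := (norm_add_le _ _).trans (by linarith)
    _ ≤ _ := Real.add_one_le_exp _

/-- Two functions with the same derivative at `0` have asymptotically equal Euler products. -/
theorem tendsto_pow_sub_pow_of_tendsto_slope {E : Type*} [NormedRing E] [NormedAlgebra ℂ E]
    (h1 : ‖(1 : E)‖ ≤ 1) {f g : ℝ≥0 → E} {ω : E}
    (hf : Tendsto (fun t : ℝ≥0 => ((t : ℝ) : ℂ)⁻¹ • (f t - 1)) (𝓝[>] 0) (𝓝 ω))
    (hg : Tendsto (fun t : ℝ≥0 => ((t : ℝ) : ℂ)⁻¹ • (g t - 1)) (𝓝[>] 0) (𝓝 ω))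
    {t : ℝ≥0} (ht : 0 < t) :
    Tendsto (fun n : ℕ => f (t / n) ^ n - g (t / n) ^ n) atTop (𝓝 0) := by
  have hlim : Tendsto (fun n : ℕ => t / n) atTop (𝓝[>] (0 : ℝ≥0)) := by
    refine tendsto_nhdsWithin_iff.2 ⟨?_, ?_⟩
    · exact tendsto_const_div_atTop_nhds_zero_nat t
    · filter_upwards [eventually_gt_atTop 0] with n hn
      exact div_pos ht (by exact_mod_cast hn)
  have hfg := (hf.sub hg).norm.comp hlim
  simp only [sub_self, norm_zero] at hfg
  refine squeeze_zero_norm' (a := fun n : ℕ => Real.exp ((‖ω‖ + 1) * t) * t *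
    ‖(((t / n : ℝ≥0) : ℝ) : ℂ)⁻¹ • (f (t / n) - 1) - (((t / n : ℝ≥0) : ℝ) : ℂ)⁻¹ • (g (t / n) - 1)‖)
    ?_ ?_
  · filter_upwards [hlim.eventually (exists_eventually_norm_le_exp h1 hf),
      hlim.eventually (exists_eventually_norm_le_exp h1 hg), eventually_gt_atTop 0] with n hfn hgn hn
    have hn' : (0 : ℝ) < n := by exact_mod_cast hn
    have ht' : (0 : ℝ) < t := ht
    refine (norm_pow_sub_pow_le_mul h1 (Real.one_le_exp (by positivity)) hfn hgn n).trans_eq ?_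
    rw [← smul_sub, norm_smul, norm_inv, Complex.norm_real, Real.norm_of_nonneg (by positivity),
      ← Real.exp_nat_mul, sub_sub_sub_cancel_right]
    push_cast
    rw [show (n : ℝ) * ((‖ω‖ + 1) * (t / n)) = (‖ω‖ + 1) * t by field_simp]
    field_simp
  · simpa using hfg.const_mul (Real.exp ((‖ω‖ + 1) * t) * t)

theorem eq_div_pow_of_add_eq_mul {E : Type*} [Monoid E] {F : ℝ≥0 → E} (h0 : F 0 = 1)
    (hadd : ∀ t u, F (t + u) = F t * F u) (t : ℝ≥0) {n : ℕ} (hn : n ≠ 0) :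
    F t = F (t / n) ^ n := by
  have key : ∀ (m : ℕ) (u : ℝ≥0), F (m * u) = F u ^ m := by
    intro m u
    induction m with
    | zero => simpa using h0
    | succ m ih => rw [pow_succ, ← ih, ← hadd]; push_cast; ring_nf
  rw [← key]
  congr 1
  field_simp

end

namespace IsCPDKernel
open Filter Topology

variable {S : Type*} {B : Type*} [CStarAlgebra B] {K L : S → S → B →L[ℂ] B}

theorem iff_nonneg [PartialOrder B] [StarOrderedRing B] :
    IsCPDKernel K ↔ ∀ (n : ℕ) (s : Fin n → S) (a b : Fin n → B),
      0 ≤ ∑ i, ∑ j, star (b i) * K (s i) (s j) (star (a i) * a j) * b j := by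
  simp only [IsCPDKernel, CStarAlgebra.nonneg_iff_eq_star_mul_self]

protected theorem zero : IsCPDKernel (0 : S → S → B →L[ℂ] B) :=
  fun n s a b => ⟨0, by simp⟩

protected theorem one : IsCPDKernel (1 : S → S → B →L[ℂ] B) :=
  fun n s a b => ⟨∑ i, a i * b i, by
    simp [Finset.sum_mul_sum, mul_assoc]⟩

protected theorem elemCPD (c : S → ℝ≥0 → B) (t : ℝ≥0) : IsCPDKernel (elemCPD c t) :=
  fun n s a b => ⟨∑ i, a i * c (s i) t * b i, by
    simp [Finset.sum_mul_sum, mul_assoc, _root_.elemCPD]⟩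

protected theorem add (hK : IsCPDKernel K) (hL : IsCPDKernel L) : IsCPDKernel (K + L) := by
  let := CStarAlgebra.spectralOrder B
  have := CStarAlgebra.spectralOrderedRing B
  rw [iff_nonneg] at *
  intro n s a b
  simpa [mul_add, add_mul, Finset.sum_add_distrib] using add_nonneg (hK n s a b) (hL n s a b)

protected theorem smul (hK : IsCPDKernel K) (r : ℝ≥0) : IsCPDKernel (((r : ℝ) : ℂ) • K) := by
  intro n s a b
  obtain ⟨y, hy⟩ := hK n s a b
  refine ⟨((NNReal.sqrt r : ℝ) : ℂ) • y, ?_⟩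
  simp [smul_smul, ← Finset.smul_sum, hy]

/-- CPD-kernels are closed under pointwise limits. -/
theorem of_tendsto {ι : Type*} {l : Filter ι} [l.NeBot] {F : ι → S → S → B →L[ℂ] B}
    (hF : ∀ᶠ i in l, IsCPDKernel (F i)) (hlim : Tendsto F l (𝓝 K)) : IsCPDKernel K := by
  let := CStarAlgebra.spectralOrder B
  have := CStarAlgebra.spectralOrderedRing B
  simp only [iff_nonneg] at *
  intro n s a b
  refine ge_of_tendsto (b := 0) ?_ (hF.mono fun i hi => hi n s a b)
  refine tendsto_finsetSum _ fun i _ => tendsto_finsetSum _ fun j _ => ?_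
  refine Tendsto.mul_const _ (Tendsto.const_mul _ ?_)
  have h := tendsto_pi_nhds.1 (tendsto_pi_nhds.1 hlim (s i)) (s j)
  exact (ContinuousLinearMap.apply ℂ B (star (a i) * a j)).continuous.continuousAt.tendsto.comp h

/-- The matrix `(L^{sᵢ,sⱼ}(aᵢ* aⱼ))ᵢⱼ` of a CPD-kernel has the form `Y* Y`. -/
theorem exists_eq_sum_star_mul (hL : IsCPDKernel L) {n : ℕ} (s : Fin n → S) (a : Fin n → B) :
    ∃ y : Fin n → Fin n → B,
      ∀ i j, L (s i) (s j) (star (a i) * a j) = ∑ k, star (y k i) * y k j := by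
  let := CStarAlgebra.spectralOrder B
  have := CStarAlgebra.spectralOrderedRing B
  rw [iff_nonneg] at hL
  obtain ⟨y, hy⟩ := Matrix.exists_eq_conjTranspose_mul_self_of_dotProduct_mulVec_nonneg
    (M := Matrix.of fun i j => L (s i) (s j) (star (a i) * a j)) fun b => by
      simpa [dotProduct, Matrix.mulVec, Finset.mul_sum, mul_assoc] using hL n s a b
  exact ⟨y, fun i j => congrFun (congrFun hy i) j⟩

/-- The Schur product (pointwise composition) of CPD-kernels is CPD. -/
protected theorem mul (hK : IsCPDKernel K) (hL : IsCPDKernel L) : IsCPDKernel (K * L) := by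
  let := CStarAlgebra.spectralOrder B
  have := CStarAlgebra.spectralOrderedRing B
  rw [iff_nonneg] at hK ⊢
  intro n s a b
  obtain ⟨y, hy⟩ := hL.exists_eq_sum_star_mul s a
  have hsum : ∑ i, ∑ j, star (b i) * (K * L) (s i) (s j) (star (a i) * a j) * b j =
      ∑ k, ∑ i, ∑ j, star (b i) * K (s i) (s j) (star (y k i) * y k j) * b j := by
    simp only [Pi.mul_apply, mul_apply_eq_comp, hy, map_sum, Finset.mul_sum,
      Finset.sum_mul]
    rw [Finset.sum_comm (f := fun k i => ∑ j, star (b i) * K (s i) (s j) (star (y k i) * y k j) * b j)]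
    exact Finset.sum_congr rfl fun i _ => Finset.sum_comm
  rw [hsum]
  exact Finset.sum_nonneg fun k _ => hK n s (y k) b

/-- Pointwise powers preserve domination of CPD-kernels. -/
theorem pow_sub_pow (hL : IsCPDKernel L) (hKL : IsCPDKernel (K - L)) (n : ℕ) :
    IsCPDKernel (K ^ n) ∧ IsCPDKernel (K ^ n - L ^ n) := by
  have hK : IsCPDKernel K := by simpa using hKL.add hL
  induction n with
  | zero => simpa using ⟨IsCPDKernel.one, IsCPDKernel.zero⟩
  | succ n ih =>
    refine ⟨by simpa [pow_succ] using ih.1.mul hK, ?_⟩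
    have hsplit : K ^ (n + 1) - L ^ (n + 1) = K ^ n * (K - L) + (K ^ n - L ^ n) * L := by
      rw [mul_sub, sub_mul, pow_succ, pow_succ, sub_add_sub_cancel]
    rw [hsplit]
    exact (ih.1.mul hKL).add (ih.2.mul hL)

end IsCPDKernel

section
open Filter Topology
variable {S : Type*} {B : Type*} [CStarAlgebra B]

theorem continuous_exp_smul (β : B) :
    Continuous fun t : ℝ≥0 => NormedSpace.exp (((t : ℝ) : ℂ) • β) := by
  let : NormedAlgebra ℚ B := .restrictScalars ℚ ℂ B
  fun_prop

theorem isOneParamSemigroup_exp_smul (β : B) :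
    IsOneParamSemigroup fun t : ℝ≥0 => NormedSpace.exp (((t : ℝ) : ℂ) • β) := by
  let : NormedAlgebra ℚ B := .restrictScalars ℚ ℂ B
  refine ⟨by simp, fun t u => ?_⟩
  beta_reduce
  rw [← NormedSpace.exp_add_of_commute (((Commute.refl β).smul_left _).smul_right _), ← add_smul]
  simp

theorem elemCPD_zero {c : S → ℝ≥0 → B} (hc : ∀ s, IsOneParamSemigroup (c s)) :
    elemCPD c 0 = 1 := by
  ext s s' b
  simp [elemCPD, (hc _).1]

theorem elemCPD_add {c : S → ℝ≥0 → B} (hc : ∀ s, IsOneParamSemigroup (c s)) (t u : ℝ≥0) :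
    elemCPD c (t + u) = elemCPD c t * elemCPD c u := by
  ext s s' b
  rw [add_comm t u]
  simp [elemCPD, (hc _).2, mul_assoc]

theorem ContinuousLinearMap.hasDerivAt_apply₂ {𝕜 E F G : Type*} [NontriviallyNormedField 𝕜]
    [NormedAddCommGroup E] [NormedSpace 𝕜 E] [NormedAddCommGroup F] [NormedSpace 𝕜 F]
    [NormedAddCommGroup G] [NormedSpace 𝕜 G] (Φ : E →L[𝕜] F →L[𝕜] G) {f : 𝕜 → E} {g : 𝕜 → F}
    {f' : E} {g' : F} {z : 𝕜} (hf : HasDerivAt f f' z) (hg : HasDerivAt g g' z) :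
    HasDerivAt (fun w => Φ (f w) (g w)) (Φ f' (g z) + Φ (f z) g') z :=
  HasDerivAt.clm_apply (Φ.hasFDerivAt.comp_hasDerivAt z hf) hg

theorem hasDerivAt_mulLeftRight_exp_smul (x y : B) :
    HasDerivAt (fun z : ℂ => ContinuousLinearMap.mulLeftRight ℂ B (NormedSpace.exp (z • x))
      (NormedSpace.exp (z • y)))
      (ContinuousLinearMap.mulLeftRight ℂ B x 1 + ContinuousLinearMap.mulLeftRight ℂ B 1 y) 0 := by
  have h1 := hasDerivAt_exp_smul_const (𝕂 := ℂ) x (0 : ℂ)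
  have h2 := hasDerivAt_exp_smul_const (𝕂 := ℂ) y (0 : ℂ)
  simp only [zero_smul, NormedSpace.exp_zero, one_mul] at h1 h2
  simpa only [zero_smul, NormedSpace.exp_zero] using
    (ContinuousLinearMap.mulLeftRight ℂ B).hasDerivAt_apply₂ h1 h2

theorem tendsto_slope_elemCPD_exp (β : S → B) (s s' : S) :
    Tendsto (fun t : ℝ≥0 => ((t : ℝ) : ℂ)⁻¹ •
      (elemCPD (fun s t => NormedSpace.exp (((t : ℝ) : ℂ) • β s)) t s s' - 1)) (𝓝[>] 0)
      (𝓝 (ContinuousLinearMap.mulLeftRight ℂ B (star (β s)) 1 +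
        ContinuousLinearMap.mulLeftRight ℂ B 1 (β s'))) := by
  have hlim : Tendsto (fun t : ℝ≥0 => ((t : ℝ) : ℂ)) (𝓝[>] 0) (𝓝[≠] 0) := by
    refine tendsto_nhdsWithin_iff.2 ⟨?_, ?_⟩
    · exact ((Complex.continuous_ofReal.comp NNReal.continuous_coe).tendsto' 0 0
        (by simp)).mono_left nhdsWithin_le_nhds
    · filter_upwards [self_mem_nhdsWithin] with t ht
      simpa using ne_of_gt ht
  refine ((hasDerivAt_iff_tendsto_slope_zero.1
    (hasDerivAt_mulLeftRight_exp_smul (star (β s)) (β s'))).comp hlim).congr fun t => ?_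
  simp only [Function.comp_apply, zero_add]
  congr 1
  ext b
  simp [elemCPD, NormedSpace.star_exp]

/-- The semigroups generated by the `β s` of a Christensen–Evans generator form a unit. -/
theorem IsCPDSemigroup.isUnitFor_exp {T : ℝ≥0 → S → S → B →L[ℂ] B} (hT : IsCPDSemigroup T)
    {Ω Ω₀ : S → S → B →L[ℂ] B} {β : S → B}
    (hΩ : ∀ s s', Tendsto (fun t : ℝ≥0 => ((t : ℝ) : ℂ)⁻¹ • (T t s s' - 1)) (𝓝[>] 0)
      (𝓝 (Ω s s')))
    (hΩ₀ : IsCPDKernel Ω₀)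
    (hdecomp : ∀ s s' b, Ω s s' b = Ω₀ s s' b + b * β s' + star (β s) * b) :
    IsUnitFor (fun s t => NormedSpace.exp (((t : ℝ) : ℂ) • β s)) T := by
  set c : S → ℝ≥0 → B := fun s t => NormedSpace.exp (((t : ℝ) : ℂ) • β s)
  have hsg : ∀ s, IsOneParamSemigroup (c s) := fun s => isOneParamSemigroup_exp_smul (β s)
  have hT0 : T 0 = 1 := by
    ext s s' : 2
    exact hT.2.1 s s'
  have hTadd : ∀ t u, T (t + u) = T t * T u := fun t u => by
    ext s s' : 2
    exact hT.2.2 t u s s'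
  refine ⟨fun s => ⟨continuous_exp_smul (β s), hsg s⟩, fun t => ?_⟩
  change IsCPDKernel (T t - elemCPD c t)
  rcases eq_zero_or_pos t with rfl | ht
  · rw [hT0, elemCPD_zero hsg, sub_self]
    exact .zero
  let U : ℝ≥0 → S → S → B →L[ℂ] B := fun h => elemCPD c h + ((h : ℝ) : ℂ) • Ω₀
  have hU : ∀ s s', Tendsto (fun h : ℝ≥0 => ((h : ℝ) : ℂ)⁻¹ • (U h s s' - 1)) (𝓝[>] 0)
      (𝓝 (Ω s s')) := fun s s' => by
    have hlim : Ω s s' = (ContinuousLinearMap.mulLeftRight ℂ B (star (β s)) 1 +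
        ContinuousLinearMap.mulLeftRight ℂ B 1 (β s')) + Ω₀ s s' := by
      ext b
      simp [hdecomp]
      abel
    rw [hlim]
    refine ((tendsto_slope_elemCPD_exp β s s').add_const _).congr' ?_
    filter_upwards [self_mem_nhdsWithin] with h hh
    have hh' : ((h : ℝ) : ℂ) ≠ 0 := by simpa using ne_of_gt hh
    simp only [U, Pi.add_apply, Pi.smul_apply, add_sub_right_comm, smul_add, inv_smul_smul₀ hh']
    rfl
  refine IsCPDKernel.of_tendsto (l := atTop)
    (F := fun n : ℕ => U (t / n) ^ n - elemCPD c (t / n) ^ n) (.of_forall fun n => ?_) ?_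
  · refine ((IsCPDKernel.elemCPD c _).pow_sub_pow ?_ n).2
    simpa [U] using hΩ₀.smul (t / n)
  · refine tendsto_pi_nhds.2 fun s => tendsto_pi_nhds.2 fun s' => ?_
    have hdiff := tendsto_pow_sub_pow_of_tendsto_slope
      (ContinuousLinearMap.norm_id_le (𝕜 := ℂ) (E := B)) (hU s s') (hΩ s s') ht
    have hsum := hdiff.add_const (T t s s' - elemCPD c t s s')
    rw [zero_add] at hsum
    refine hsum.congr' ?_
    filter_upwards [eventually_ne_atTop 0] with n hn
    rw [eq_div_pow_of_add_eq_mul hT0 hTadd t hn,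
      eq_div_pow_of_add_eq_mul (elemCPD_zero hsg) (elemCPD_add hsg) t hn]
    simp

end

/-- A CPD-semigroup on a unital C*-algebra which has a
Christensen–Evans generator is spatial. -/
theorem CPDSemigroup_of_ChristensenEvansGenerator_isSpatial
    {S : Type*} {B : Type*} [CStarAlgebra B]
    (T : ℝ≥0 → S → S → B →L[ℂ] B)
    (hT : IsCPDSemigroup T)
    (hCE : HasChristensenEvansGenerator T) :
    IsSpatialCPDSemigroup T := by
  obtain ⟨Ω, hΩ, Ω₀, β, hΩ₀, hdecomp⟩ := hCE
  exact ⟨_, hT.isUnitFor_exp hΩ hΩ₀ hdecomp⟩
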